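/- Let Z be a standard normal random variable and for t ∈ (0,1) define Y_t := 1(Z ≤ Φ⁻¹(t)) − t + φ(Φ⁻¹(t))·Z + (1/2)Φ⁻¹(t)φ(Φ⁻¹(t))·(Z² − 1). Then E[Y_t] = 0 for every t ∈ (0,1), and for all t, s ∈ (0,1), E[Y_t·Y_s] = min(t,s) − t·s − φ(Φ⁻¹(t))φ(Φ⁻¹(s)) − (1/2)Φ⁻¹(t)φ(Φ⁻¹(t))·Φ⁻¹(s)φ(Φ⁻¹(s)). -/

import Mathlib

open MeasureTheory ProbabilityTheory Set

/-- The standard normal distribution function `Φ`. -/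
noncomputable def stdNormalCDF : ℝ → ℝ := fun x => cdf (gaussianReal 0 1) x

/-- The standard normal density `φ(x) = (2π)^{-1/2} e^{-x²/2}`. -/
noncomputable def stdNormalPDF : ℝ → ℝ :=
  fun x => (Real.sqrt (2 * Real.pi))⁻¹ * Real.exp (-(x ^ 2) / 2)

/-- The inverse `Φ⁻¹ : (0,1) → ℝ` of the standard normal distribution function. -/
noncomputable def stdNormalQuantile : ℝ → ℝ := Function.invFun stdNormalCDF

lemma gaussianPDFReal_zero_one (x : ℝ) : gaussianPDFReal 0 1 x = stdNormalPDF x := by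
  simp [gaussianPDFReal, stdNormalPDF]

lemma hasDerivAt_stdNormalPDF (x : ℝ) : HasDerivAt stdNormalPDF (-x * stdNormalPDF x) x := by
  have h : HasDerivAt (fun x : ℝ => -(x ^ 2) / 2) (-x) x := by
    convert! ((hasDerivAt_pow 2 x).neg.div_const 2) using 1
    push_cast
    ring
  convert! (h.exp.const_mul (Real.sqrt (2 * Real.pi))⁻¹) using 1
  simp only [stdNormalPDF]
  ring

lemma integrable_gaussianReal_zero_one_iff {f : ℝ → ℝ} :
    Integrable f (gaussianReal 0 1) ↔ Integrable (fun x => stdNormalPDF x * f x) := by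
  rw [gaussianReal_of_var_ne_zero _ one_ne_zero,
    integrable_withDensity_iff_integrable_smul' (measurable_gaussianPDF _ _)
      (ae_of_all _ fun _ => gaussianPDF_lt_top)]
  simp [toReal_gaussianPDF, gaussianPDFReal_zero_one]

lemma integrable_polynomial_gaussianReal (p : Polynomial ℝ) (m : ℝ) (v : NNReal) :
    Integrable (fun x => p.eval x) (gaussianReal m v) := by
  simp_rw [Polynomial.eval_eq_sum_range]
  refine integrable_finsetSum _ fun n _ => Integrable.const_mul ?_ _
  have h := (memLp_id_gaussianReal (μ := m) (v := v) n).integrable_norm_pow'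
  refine (integrable_norm_iff (by fun_prop)).1 ?_
  simpa using h

lemma hasDerivAt_stdNormalPDF_mul_polynomial (p : Polynomial ℝ) (x : ℝ) :
    HasDerivAt (fun x => stdNormalPDF x * p.eval x)
      (stdNormalPDF x * (p.derivative - Polynomial.X * p).eval x) x := by
  convert! (hasDerivAt_stdNormalPDF x).mul (p.hasDerivAt x) using 1
  simp
  ring

lemma integrable_stdNormalPDF_mul_polynomial (p : Polynomial ℝ) :
    Integrable (fun x => stdNormalPDF x * p.eval x) :=
  integrable_gaussianReal_zero_one_iff.1 (integrable_polynomial_gaussianReal p 0 1)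

/-- Stein's identity for polynomials. -/
lemma integral_stein_polynomial (p : Polynomial ℝ) :
    ∫ x, (p.derivative - Polynomial.X * p).eval x ∂gaussianReal 0 1 = 0 := by
  rw [integral_gaussianReal_eq_integral_smul one_ne_zero]
  simp_rw [gaussianPDFReal_zero_one, smul_eq_mul]
  exact integral_eq_zero_of_hasDerivAt_of_integrable (hasDerivAt_stdNormalPDF_mul_polynomial p)
    (integrable_stdNormalPDF_mul_polynomial _) (integrable_stdNormalPDF_mul_polynomial p)

/-- Stein's identity for polynomials on a half-line. -/
lemma setIntegral_Iic_stein_polynomial (p : Polynomial ℝ) (c : ℝ) :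
    ∫ x in Iic c, (p.derivative - Polynomial.X * p).eval x ∂gaussianReal 0 1
      = stdNormalPDF c * p.eval c := by
  rw [← integral_indicator measurableSet_Iic,
    integral_gaussianReal_eq_integral_smul one_ne_zero]
  simp_rw [gaussianPDFReal_zero_one, smul_eq_mul, ← indicator_mul_right]
  rw [integral_indicator measurableSet_Iic,
    integral_Iic_of_hasDerivAt_of_tendsto'
      (fun x _ => hasDerivAt_stdNormalPDF_mul_polynomial p x)
      (integrable_stdNormalPDF_mul_polynomial _).integrableOn
      (tendsto_zero_of_hasDerivAt_of_integrableOn_Iic (a := c)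
        (fun x _ => hasDerivAt_stdNormalPDF_mul_polynomial p x)
        (integrable_stdNormalPDF_mul_polynomial _).integrableOn
        (integrable_stdNormalPDF_mul_polynomial p).integrableOn), sub_zero]

lemma monotone_stdNormalCDF : Monotone stdNormalCDF := monotone_cdf _

lemma stdNormalCDF_eq_measureReal (x : ℝ) :
    stdNormalCDF x = (gaussianReal 0 1).real (Iic x) := cdf_eq_real _ x

lemma continuous_stdNormalCDF : Continuous stdNormalCDF := by
  have hcdf : stdNormalCDF = fun x => ∫ y in Iic x, stdNormalPDF y := by
    ext x
    rw [stdNormalCDF_eq_measureReal, ← integral_indicator_one measurableSet_Iic,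
      integral_gaussianReal_eq_integral_smul one_ne_zero, ← integral_indicator measurableSet_Iic]
    refine integral_congr_ae (ae_of_all _ fun y => ?_)
    simp [gaussianPDFReal_zero_one, indicator_apply]
  have hint : Integrable stdNormalPDF := by
    simpa using integrable_stdNormalPDF_mul_polynomial 1
  rw [hcdf]
  refine continuous_iff_continuousAt.2 fun x => ?_
  have h : ∀ y, ∫ z in Iic y, stdNormalPDF z
      = (∫ z in Iic x, stdNormalPDF z) + ∫ z in x..y, stdNormalPDF z := fun y => by
    rw [← intervalIntegral.integral_Iic_sub_Iic hint.integrableOn hint.integrableOn]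
    ring
  rw [funext h]
  exact (continuous_const.add (intervalIntegral.continuous_primitive
    (fun _ _ => hint.intervalIntegrable) x)).continuousAt

lemma stdNormalCDF_quantile {t : ℝ} (ht : t ∈ Ioo (0 : ℝ) 1) :
    stdNormalCDF (stdNormalQuantile t) = t := by
  refine Function.invFun_eq (mem_range_of_exists_le_of_exists_ge continuous_stdNormalCDF ?_ ?_)
  · exact ((tendsto_cdf_atBot (gaussianReal 0 1)).eventually_le_const ht.1).exists
  · exact ((tendsto_cdf_atTop (gaussianReal 0 1)).eventually_const_le ht.2).exists

/-- The quadratic `-t + a x + b (x² - 1)`. -/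
noncomputable def hermiteQuadratic (t a b : ℝ) : Polynomial ℝ :=
  -Polynomial.C t + Polynomial.C a * Polynomial.X + Polynomial.C b * (Polynomial.X ^ 2 - 1)

lemma hermiteQuadratic_eq_stein (t a b : ℝ) :
    hermiteQuadratic t a b = -Polynomial.C t +
      ((-Polynomial.C a - Polynomial.C b * Polynomial.X).derivative
        - Polynomial.X * (-Polynomial.C a - Polynomial.C b * Polynomial.X)) := by
  simp [hermiteQuadratic]
  ring

lemma integral_hermiteQuadratic (t a b : ℝ) :
    ∫ x, (hermiteQuadratic t a b).eval x ∂gaussianReal 0 1 = -t := by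
  rw [hermiteQuadratic_eq_stein]
  simp_rw [Polynomial.eval_add]
  rw [integral_add (integrable_polynomial_gaussianReal _ _ _)
    (integrable_polynomial_gaussianReal _ _ _), integral_stein_polynomial]
  simp

lemma setIntegral_Iic_hermiteQuadratic (t a b c : ℝ) :
    ∫ x in Iic c, (hermiteQuadratic t a b).eval x ∂gaussianReal 0 1
      = -t * stdNormalCDF c - a * stdNormalPDF c - b * (c * stdNormalPDF c) := by
  rw [hermiteQuadratic_eq_stein]
  simp_rw [Polynomial.eval_add]
  rw [integral_add (integrable_polynomial_gaussianReal _ _ _).integrableOn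
    (integrable_polynomial_gaussianReal _ _ _).integrableOn, setIntegral_Iic_stein_polynomial,
    stdNormalCDF_eq_measureReal]
  simp
  ring

lemma integral_hermiteQuadratic_mul (t a b s a' b' : ℝ) :
    ∫ x, (hermiteQuadratic t a b * hermiteQuadratic s a' b').eval x ∂gaussianReal 0 1
      = t * s + a * a' + 2 * b * b' := by
  -- primitive of the centred product with respect to the Gaussian weight
  let p : Polynomial ℝ := Polynomial.C (t * a' + s * a) + Polynomial.C (t * b' + s * b - a * a')
      * Polynomial.X - Polynomial.C (a * b' + b * a') * (Polynomial.X ^ 2 + 1)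
      - Polynomial.C (b * b') * (Polynomial.X ^ 3 + Polynomial.X)
  have h : hermiteQuadratic t a b * hermiteQuadratic s a' b'
      = Polynomial.C (t * s + a * a' + 2 * b * b') + (p.derivative - Polynomial.X * p) := by
    refine Polynomial.funext fun x => ?_
    simp [hermiteQuadratic, p]
    ring
  simp_rw [h, Polynomial.eval_add]
  rw [integral_add (integrable_polynomial_gaussianReal _ _ _)
    (integrable_polynomial_gaussianReal _ _ _), integral_stein_polynomial]
  simp

lemma integral_indicator_add_polynomial_mul (x y : ℝ) (p q : Polynomial ℝ) :
    ∫ z, ((Iic x).indicator 1 z + p.eval z) * ((Iic y).indicator 1 z + q.eval z)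
        ∂gaussianReal 0 1
      = stdNormalCDF (min x y) + (∫ z in Iic x, q.eval z ∂gaussianReal 0 1)
        + (∫ z in Iic y, p.eval z ∂gaussianReal 0 1)
        + ∫ z, (p * q).eval z ∂gaussianReal 0 1 := by
  have hp := integrable_polynomial_gaussianReal p 0 1
  have hq := integrable_polynomial_gaussianReal q 0 1
  have h : ∀ z, ((Iic x).indicator 1 z + p.eval z) * ((Iic y).indicator 1 z + q.eval z)
      = (Iic (min x y)).indicator (1 : ℝ → ℝ) z + (Iic x).indicator (fun z => q.eval z) z
        + (Iic y).indicator (fun z => p.eval z) z + (p * q).eval z := fun z => by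
    by_cases hx : z ≤ x <;> by_cases hy : z ≤ y <;> simp [hx, hy] <;> ring
  have h1 : Integrable ((Iic (min x y)).indicator (1 : ℝ → ℝ)) (gaussianReal 0 1) :=
    (integrable_const (1 : ℝ)).indicator measurableSet_Iic
  have h2 := hq.indicator (measurableSet_Iic (a := x))
  have h3 := hp.indicator (measurableSet_Iic (a := y))
  simp_rw [h]
  rw [integral_add (by fun_prop) (integrable_polynomial_gaussianReal _ _ _),
    integral_add (by fun_prop) h3, integral_add h1 h2, integral_indicator_one measurableSet_Iic,
    integral_indicator measurableSet_Iic, integral_indicator measurableSet_Iic,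
    stdNormalCDF_eq_measureReal]

/-- For a standard normal `Z` and
`Y_t = 1(Z ≤ Φ⁻¹(t)) - t + φ(Φ⁻¹(t)) Z + ½ Φ⁻¹(t) φ(Φ⁻¹(t)) (Z² - 1)`, one has `E[Y_t] = 0`
and `E[Y_t Y_s] = min(t,s) - ts - φ(Φ⁻¹(t))φ(Φ⁻¹(s)) - ½ Φ⁻¹(t)φ(Φ⁻¹(t)) Φ⁻¹(s)φ(Φ⁻¹(s))`. -/
theorem limit_process_covariance
    {Ω : Type*} [MeasurableSpace Ω] (P : Measure Ω) [IsProbabilityMeasure P]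
    (Z : Ω → ℝ) (hZ : Measurable Z) (hlaw : Measure.map Z P = gaussianReal 0 1) :
    let Y : ℝ → Ω → ℝ := fun t ω =>
      (if Z ω ≤ stdNormalQuantile t then (1 : ℝ) else 0) - t
        + stdNormalPDF (stdNormalQuantile t) * Z ω
        + (1 / 2) * stdNormalQuantile t * stdNormalPDF (stdNormalQuantile t) * ((Z ω) ^ 2 - 1)
    (∀ t ∈ Set.Ioo (0 : ℝ) 1, ∫ ω, Y t ω ∂P = 0) ∧
    (∀ t ∈ Set.Ioo (0 : ℝ) 1, ∀ s ∈ Set.Ioo (0 : ℝ) 1,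
      ∫ ω, Y t ω * Y s ω ∂P
        = min t s - t * s
          - stdNormalPDF (stdNormalQuantile t) * stdNormalPDF (stdNormalQuantile s)
          - (1 / 2) * stdNormalQuantile t * stdNormalPDF (stdNormalQuantile t)
            * (stdNormalQuantile s * stdNormalPDF (stdNormalQuantile s))) := by
  intro Y
  let p : ℝ → Polynomial ℝ := fun t => hermiteQuadratic t (stdNormalPDF (stdNormalQuantile t))
    (1 / 2 * stdNormalQuantile t * stdNormalPDF (stdNormalQuantile t))
  let g : ℝ → ℝ → ℝ := fun t z => (Iic (stdNormalQuantile t)).indicator 1 z + (p t).eval z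
  have hY : ∀ t ω, Y t ω = g t (Z ω) := fun t ω => by
    simp [Y, g, p, hermiteQuadratic, indicator_apply]
    ring
  have hg : ∀ t, Measurable (g t) := fun t =>
    (measurable_one.indicator measurableSet_Iic).add (p t).continuous.measurable
  simp_rw [hY]
  refine ⟨fun t ht => ?_, fun t ht s hs => ?_⟩
  · rw [← integral_map (f := g t) hZ.aemeasurable (hg t).aestronglyMeasurable, hlaw]
    have h1 : Integrable ((Iic (stdNormalQuantile t)).indicator (1 : ℝ → ℝ)) (gaussianReal 0 1) :=
      (integrable_const (1 : ℝ)).indicator measurableSet_Iic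
    rw [integral_add h1 (integrable_polynomial_gaussianReal _ _ _),
      integral_indicator_one measurableSet_Iic, ← stdNormalCDF_eq_measureReal,
      stdNormalCDF_quantile ht, integral_hermiteQuadratic, add_neg_cancel]
  · rw [← integral_map (f := fun z => g t z * g s z) hZ.aemeasurable
      ((hg t).mul (hg s)).aestronglyMeasurable, hlaw, integral_indicator_add_polynomial_mul,
      setIntegral_Iic_hermiteQuadratic, setIntegral_Iic_hermiteQuadratic,
      integral_hermiteQuadratic_mul, monotone_stdNormalCDF.map_min, stdNormalCDF_quantile ht,
      stdNormalCDF_quantile hs]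
    ring
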